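/- arXiv:0909.4863 — 2 statements merged into one kernel-verified Lean document; each statement's English description precedes it below -/
import Mathlib

section
/- Let R be a commutative ring, E an R-module, and M an R-module. Then the injective dimension of M over R is at most its injective dimension over R⋉E, where M is an R⋉E-module via ε: R⋉E → R. -/
open CategoryTheory TrivSqZeroExt

noncomputable section

universe u

/-- The canonical projection `ε : R⋉E → R`, `ε (r, e) = r`. -/
def paperEps (R E : Type u) [CommRing R] [AddCommGroup E] [Module R E]
    [Module Rᵐᵒᵖ E] [IsCentralScalar R E] : TrivSqZeroExt R E →+* R :=
  (TrivSqZeroExt.fstHom R R E).toRingHom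

/-- `M` has a left resolution of length `≤ n` by modules satisfying `P`. -/
def HasLeftResLE (R : Type u) [CommRing R] (P : ModuleCat.{u} R → Prop)
    (M : Type u) [AddCommGroup M] [Module R M] (n : ℕ) : Prop :=
  ∃ (G : ℕ → ModuleCat.{u} R) (d : ∀ i, G (i + 1) ⟶ G i) (aug : G 0 ⟶ ModuleCat.of R M),
    (∀ i, P (G i)) ∧ (∀ i, n < i → Subsingleton (G i)) ∧
    Function.Surjective aug ∧ Function.Exact (d 0) aug ∧
    ∀ i, Function.Exact (d (i + 1)) (d i)

/-- `M` has a right (co)resolution of length `≤ n` by modules satisfying `P`. -/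
def HasRightResLE (R : Type u) [CommRing R] (P : ModuleCat.{u} R → Prop)
    (M : Type u) [AddCommGroup M] [Module R M] (n : ℕ) : Prop :=
  ∃ (G : ℕ → ModuleCat.{u} R) (d : ∀ i, G i ⟶ G (i + 1)) (aug : ModuleCat.of R M ⟶ G 0),
    (∀ i, P (G i)) ∧ (∀ i, n < i → Subsingleton (G i)) ∧
    Function.Injective aug ∧ Function.Exact aug (d 0) ∧
    ∀ i, Function.Exact (d i) (d (i + 1))

/-- Projective dimension of `M` over `R`, as an element of `ℕ∞`. -/
def projDim (R : Type u) [CommRing R] (M : Type u) [AddCommGroup M] [Module R M] : ℕ∞ :=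
  sInf ((fun n : ℕ => (n : ℕ∞)) '' {n : ℕ | HasLeftResLE R (fun N => Module.Projective R N) M n})

/-- Flat dimension of `M` over `R`, as an element of `ℕ∞`. -/
def flatDim (R : Type u) [CommRing R] (M : Type u) [AddCommGroup M] [Module R M] : ℕ∞ :=
  sInf ((fun n : ℕ => (n : ℕ∞)) '' {n : ℕ | HasLeftResLE R (fun N => Module.Flat R N) M n})

/-- Injective dimension of `M` over `R`, as an element of `ℕ∞`. -/
def injDim (R : Type u) [CommRing R] (M : Type u) [AddCommGroup M] [Module R M] : ℕ∞ :=
  sInf ((fun n : ℕ => (n : ℕ∞)) '' {n : ℕ | HasRightResLE R (fun N => Module.Injective R N) M n})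

theorem aux_ext {A B : Type u} [CommRing A] [CommRing B] (e : A →+* B)
    {N N' J : Type u} [AddCommGroup N] [Module B N] [AddCommGroup N'] [Module B N']
    [AddCommGroup J] [Module A J] (hJ : Module.Injective A J)
    (i : N →ₗ[B] N') (hi : Function.Injective i)
    (φ : N →+ J) (hφ : ∀ a x, φ (e a • x) = a • φ x) :
    ∃ ψ : N' →+ J, (∀ a x, ψ (e a • x) = a • ψ x) ∧ ∀ x, ψ (i x) = φ x := by
  letI : Module A N := Module.compHom N e
  letI : Module A N' := Module.compHom N' e
  let i' : N →ₗ[A] N' :=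
    { toFun := i, map_add' := i.map_add, map_smul' := fun a x => i.map_smul (e a) x }
  let φ' : N →ₗ[A] J := { toFun := φ, map_add' := φ.map_add, map_smul' := hφ }
  obtain ⟨ψ, h⟩ := hJ.out i' hi φ'
  exact ⟨ψ.toAddMonoidHom, fun a x => ψ.map_smul a x, h⟩

theorem aux_enough (R : Type u) [CommRing R] (M : Type u) [AddCommGroup M] [Module R M] :
    ∃ (I : ModuleCat.{u} R) (j : M →ₗ[R] I), Module.Injective R I ∧ Function.Injective j := by
  obtain ⟨p⟩ := EnoughInjectives.presentation (ModuleCat.of R M)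
  have := p.injective
  exact ⟨p.J, p.f.hom, Module.injective_module_of_injective_object R p.J,
    (ModuleCat.mono_iff_injective p.f).1 p.mono⟩

theorem aux_zero (R : Type u) [CommRing R] (M : Type u) [AddCommGroup M] [Module R M]
    (hM : Module.Injective R M) : HasRightResLE R (fun N => Module.Injective R N) M 0 := by
  refine ⟨fun i => match i with
    | 0 => ModuleCat.of R M
    | _ + 1 => ModuleCat.of R PUnit, fun i => 0, 𝟙 _, ?_, ?_, ?_, ?_, ?_⟩
  · rintro (_ | i)
    · exact hM
    · exact ⟨fun X Y _ _ _ _ f hf g => ⟨0, fun x => Subsingleton.elim (α := PUnit) _ _⟩⟩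
  · rintro (_ | i) h
    · omega
    · exact inferInstanceAs (Subsingleton PUnit)
  · exact fun x y h => h
  · intro x
    exact ⟨fun _ => ⟨x, rfl⟩, fun _ => rfl⟩
  · intro i x
    exact ⟨fun _ => ⟨0, Subsingleton.elim (α := PUnit) _ _⟩,
      fun _ => Subsingleton.elim (α := PUnit) _ _⟩

theorem aux_splice (R : Type u) [CommRing R] (M : Type u) [AddCommGroup M] [Module R M]
    (I : ModuleCat.{u} R) (hI : Module.Injective R I) (j : M →ₗ[R] I)
    (hj : Function.Injective j) (n : ℕ)
    (h : HasRightResLE R (fun N => Module.Injective R N) (I ⧸ LinearMap.range j) n) :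
    HasRightResLE R (fun N => Module.Injective R N) M (n + 1) := by
  obtain ⟨G, d, aug, hG, hs, hinj, hex, hexs⟩ := h
  refine ⟨fun i => match i with
    | 0 => I
    | i + 1 => G i, fun i => match i with
    | 0 => ModuleCat.ofHom (aug.hom ∘ₗ (LinearMap.range j).mkQ)
    | i + 1 => d i, ModuleCat.ofHom j, ?_, ?_, hj, ?_, ?_⟩
  · rintro (_ | i)
    · exact hI
    · exact hG i
  · rintro (_ | i) h
    · omega
    · exact hs i (by omega)
  · intro x
    change aug.hom ((LinearMap.range j).mkQ x) = 0 ↔ x ∈ Set.range j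
    rw [map_eq_zero_iff aug.hom hinj, Submodule.mkQ_apply, Submodule.Quotient.mk_eq_zero]
    rfl
  · rintro (_ | i)
    · intro x
      change d 0 x = 0 ↔ ∃ y, aug.hom ((LinearMap.range j).mkQ y) = x
      rw [hex x]
      constructor
      · rintro ⟨y, rfl⟩
        obtain ⟨z, rfl⟩ := Submodule.mkQ_surjective _ y
        exact ⟨z, rfl⟩
      · rintro ⟨y, rfl⟩
        exact ⟨_, rfl⟩
    · exact hexs i

theorem aux_unsplice (R : Type u) [CommRing R] (M : Type u) [AddCommGroup M] [Module R M]
    (n : ℕ) (h : HasRightResLE R (fun N => Module.Injective R N) M (n + 1)) :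
    ∃ (I : ModuleCat.{u} R) (j : M →ₗ[R] I), Module.Injective R I ∧ Function.Injective j ∧
      HasRightResLE R (fun N => Module.Injective R N) (I ⧸ LinearMap.range j) n := by
  obtain ⟨G, d, aug, hG, hs, hinj, hex, hexs⟩ := h
  have hk : LinearMap.range aug.hom = LinearMap.ker (d 0).hom := by
    ext x
    exact (hex x).symm
  refine ⟨G 0, aug.hom, hG 0, hinj, fun i => G (i + 1), fun i => d (i + 1),
    ModuleCat.ofHom ((LinearMap.range aug.hom).liftQ (d 0).hom hk.le), fun i => hG _,
    fun i hi => hs _ (by omega), ?_, ?_, fun i => hexs _⟩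
  · change Function.Injective ((LinearMap.range aug.hom).liftQ (d 0).hom hk.le)
    rw [← LinearMap.ker_eq_bot]
    exact Submodule.ker_liftQ_eq_bot _ _ _ hk.ge
  · intro x
    refine (hexs 0 x).trans ?_
    constructor
    · rintro ⟨y, rfl⟩
      exact ⟨(LinearMap.range aug.hom).mkQ y, rfl⟩
    · rintro ⟨y, rfl⟩
      obtain ⟨z, rfl⟩ := Submodule.mkQ_surjective _ y
      exact ⟨z, rfl⟩

theorem aux_of_zero (R : Type u) [CommRing R] (M : Type u) [AddCommGroup M] [Module R M]
    (h : HasRightResLE R (fun N => Module.Injective R N) M 0) : Module.Injective R M := by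
  obtain ⟨G, d, aug, hG, hs, hinj, hex, hexs⟩ := h
  have hsurj : Function.Surjective aug.hom := fun x => by
    haveI := hs 1 (by omega)
    exact (hex x).1 (Subsingleton.elim _ _)
  let e := LinearEquiv.ofBijective aug.hom ⟨hinj, hsurj⟩
  refine ⟨fun X Y _ _ _ _ f hf g => ?_⟩
  obtain ⟨ψ, hψ⟩ := (hG 0).out f hf (e.toLinearMap ∘ₗ g)
  exact ⟨e.symm.toLinearMap ∘ₗ ψ, fun x => by simp [hψ]⟩

theorem aux_main {R S : Type u} [CommRing R] [CommRing S] (ε : S →+* R) (ι : R →+* S)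
    (hε : ∀ r, ε (ι r) = r) (n : ℕ) :
    ∀ (M L K : Type u) [AddCommGroup M] [Module R M] [AddCommGroup L] [Module S L]
      [AddCommGroup K] [Module R K] (_ : Module.Injective R K)
      (f : M →+ L) (_ : ∀ s m, f (ε s • m) = s • f m)
      (g : L →+ M) (_ : ∀ r l, g (ι r • l) = r • g l)
      (a : M →ₗ[R] K) (b : K →ₗ[R] M) (_ : ∀ m, m - g (f m) = b (a m)),
      HasRightResLE S (fun N => Module.Injective S N) L n →
      HasRightResLE R (fun N => Module.Injective R N) M n := by
  induction n with
  | zero =>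
    intro M L K _ _ _ _ _ _ hK f hf g hg a b hab h
    have hL := aux_of_zero S L h
    refine aux_zero R M ⟨fun X Y _ _ _ _ i hi φ => ?_⟩
    obtain ⟨ψ, h1, h2⟩ := aux_ext ε hL i hi (f.comp φ.toAddMonoidHom)
      (fun s x => by simp [hf])
    obtain ⟨θ, hθ⟩ := hK.out i hi (a ∘ₗ φ)
    let gψ : Y →ₗ[R] M :=
      { toFun := fun y => g (ψ y)
        map_add' := by simp
        map_smul' := fun r y => by
          have := h1 (ι r) y
          rw [hε] at this
          simp [this, hg] }
    refine ⟨gψ + b ∘ₗ θ, fun x => ?_⟩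
    have e1 : gψ (i x) = g (f (φ x)) := congrArg g (h2 x)
    have e2 : θ (i x) = a (φ x) := hθ x
    rw [LinearMap.add_apply, LinearMap.comp_apply, e1, e2, ← hab]
    abel
  | succ n ih =>
    intro M L K _ _ _ _ _ _ hK f hf g hg a b hab h
    obtain ⟨J, l, hJ, hl, hres⟩ := aux_unsplice S L n h
    obtain ⟨I, j, hI, hj⟩ := aux_enough R M
    obtain ⟨F, hF, hFj⟩ := aux_ext ε hJ j hj (l.toAddMonoidHom.comp f)
      (fun s x => by simp [hf])
    obtain ⟨G, hG, hGl⟩ := aux_ext ι hI l hl (j.toAddMonoidHom.comp g)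
      (fun s x => by simp [hg])
    replace hFj : ∀ x, F (j x) = l (f x) := hFj
    replace hGl : ∀ x, G (l x) = j (g x) := hGl
    obtain ⟨a', ha'⟩ := hK.out j hj a
    let GF : I →ₗ[R] I :=
      { toFun := fun y => G (F y)
        map_add' := by simp
        map_smul' := fun r y => by
          have := hF (ι r) y
          rw [hε] at this
          simp [this, hG] }
    let k : I →ₗ[R] I := LinearMap.id - GF - j ∘ₗ b ∘ₗ a'
    have hk : LinearMap.range j ≤ LinearMap.ker k := by
      rintro _ ⟨m, rfl⟩
      change j m - G (F (j m)) - j (b (a' (j m))) = 0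
      rw [ha', ← hab, hFj, hGl, map_sub]
      abel
    let F' : (I ⧸ LinearMap.range j) →+ (J ⧸ LinearMap.range l) :=
      QuotientAddGroup.map (LinearMap.range j).toAddSubgroup (LinearMap.range l).toAddSubgroup F
        (by rintro _ ⟨m, rfl⟩; exact ⟨f m, (hFj m).symm⟩)
    let G' : (J ⧸ LinearMap.range l) →+ (I ⧸ LinearMap.range j) :=
      QuotientAddGroup.map (LinearMap.range l).toAddSubgroup (LinearMap.range j).toAddSubgroup G
        (by rintro _ ⟨m, rfl⟩; exact ⟨g m, (hGl m).symm⟩)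
    have hF' : ∀ x, F' ((LinearMap.range j).mkQ x) = (LinearMap.range l).mkQ (F x) :=
      fun x => rfl
    have hG' : ∀ x, G' ((LinearMap.range l).mkQ x) = (LinearMap.range j).mkQ (G x) :=
      fun x => rfl
    refine aux_splice R M I hI j hj n
      (ih (I ⧸ LinearMap.range j) (J ⧸ LinearMap.range l) I hI F' ?_ G' ?_
        ((LinearMap.range j).liftQ k hk) (LinearMap.range j).mkQ ?_ hres)
    · intro s m
      obtain ⟨x, rfl⟩ := Submodule.mkQ_surjective _ m
      rw [← map_smul, hF', hF', hF, map_smul]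
    · intro s m
      obtain ⟨x, rfl⟩ := Submodule.mkQ_surjective _ m
      rw [← map_smul, hG', hG', hG, map_smul]
    · intro m
      obtain ⟨x, rfl⟩ := Submodule.mkQ_surjective _ m
      rw [hF', hG']
      have e : (LinearMap.range j).liftQ k hk ((LinearMap.range j).mkQ x)
          = x - G (F x) - j (b (a' x)) := rfl
      have e2 : (LinearMap.range j).mkQ (j (b (a' x))) = 0 := by
        rw [Submodule.mkQ_apply, Submodule.Quotient.mk_eq_zero]
        exact ⟨_, rfl⟩
      rw [e, map_sub, map_sub, e2, sub_zero]

theorem stmt9 (R E : Type u) [CommRing R] [AddCommGroup E] [Module R E]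
    [Module Rᵐᵒᵖ E] [IsCentralScalar R E]
    (M : Type u) [AddCommGroup M] [Module R M] :
    injDim R M ≤ @injDim (TrivSqZeroExt R E) _ M _ (Module.compHom M (paperEps R E)) := by
  letI : Module (TrivSqZeroExt R E) M := Module.compHom M (paperEps R E)
  refine sInf_le_sInf (Set.image_mono fun n hn => ?_)
  exact aux_main (paperEps R E) (TrivSqZeroExt.inlHom R E) (fun r => rfl) n M M PUnit
    ⟨fun X Y _ _ _ _ f hf g => ⟨0, fun x => Subsingleton.elim (α := PUnit) _ _⟩⟩
    (AddMonoidHom.id M) (fun _ _ => rfl) (AddMonoidHom.id M) (fun _ _ => rfl) 0 0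
    (fun m => by simp) hn
end
end

section
/- Let R be a commutative ring, E an R-module, and M an R-module. Then fd_R(M) ≤ fd_{R⋉E}(M), where fd denotes flat dimension and M is an R⋉E-module via ε: R⋉E → R. -/
open CategoryTheory TrivSqZeroExt

noncomputable section

universe u

open CategoryTheory Abelian in
theorem aux_ext_s10 {C : Type*} [Category C] [Abelian C] {D : Type*} [Category D] [Abelian D]
    [HasExt.{u} C] [HasExt.{u} D] [EnoughInjectives C]
    (F : C ⥤ D) [F.Additive] [Limits.PreservesFiniteLimits F] [Limits.PreservesFiniteColimits F]
    (G : D ⥤ C) [G.Additive] [Limits.PreservesFiniteLimits G] [Limits.PreservesFiniteColimits G]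
    (η : F ⋙ G ≅ 𝟭 C) (n : ℕ) : ∀ (X Y : C) (e : Ext.{u} X Y n),
      ((e.mapExactFunctor F).mapExactFunctor G).comp (Ext.mk₀ (η.hom.app Y)) (add_zero n) =
        (Ext.mk₀ (η.hom.app X)).comp e (zero_add n) := by
  induction n with
  | zero =>
    intro X Y e
    obtain ⟨f, rfl⟩ := (Ext.mk₀_bijective X Y).2 e
    rw [Ext.mapExactFunctor_mk₀, Ext.mapExactFunctor_mk₀]
    erw [Ext.mk₀_comp_mk₀, Ext.mk₀_comp_mk₀]
    congr 1
    exact η.hom.naturality f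
  | succ n ih =>
    intro X Y e
    let S : ShortComplex C := ShortComplex.mk (Injective.ι Y) (Limits.cokernel.π (Injective.ι Y))
      (Limits.cokernel.condition _)
    have hS : S.ShortExact :=
      { exact := ShortComplex.exact_of_g_is_cokernel _ (Limits.cokernelIsCokernel _)
        mono_f := by dsimp [S]; infer_instance
        epi_g := by dsimp [S]; infer_instance }
    have : Injective S.X₂ := by dsimp [S]; infer_instance
    obtain ⟨x, hx⟩ := Ext.covariant_sequence_exact₁ X hS (n₁ := n + 1) e
      (Ext.eq_zero_of_injective _) rfl
    have hm : (hS.extClass.mapExactFunctor F).mapExactFunctor G =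
        ((hS.map_of_exact F).map_of_exact G).extClass := by
      rw [Ext.mapExactFunctor_extClass]
      exact Ext.mapExactFunctor_extClass G (hS.map_of_exact F)
    have nat := ShortComplex.ShortExact.extClass_naturality
      ((hS.map_of_exact F).map_of_exact G) hS (S.mapNatTrans η.hom)
    have nat' : ((hS.extClass.mapExactFunctor F).mapExactFunctor G).comp
        (Ext.mk₀ (η.hom.app Y)) (add_zero 1) =
        (Ext.mk₀ (η.hom.app S.X₃)).comp hS.extClass (zero_add 1) :=
      (congrArg (fun z => Ext.comp z (Ext.mk₀ (η.hom.app Y)) (add_zero 1)) hm).trans nat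
    rw [← hx, Ext.mapExactFunctor_comp, Ext.mapExactFunctor_comp]
    refine (Ext.comp_assoc _ _ _ rfl (add_zero 1) (by simp)).trans ?_
    refine (congrArg (fun z => Ext.comp _ z rfl) nat').trans ?_
    refine (Ext.comp_assoc _ _ _ (add_zero n) (zero_add 1) (by simp)).symm.trans ?_
    refine (congrArg (fun z => Ext.comp z _ rfl) (ih X S.X₃ x)).trans ?_
    exact Ext.comp_assoc _ _ _ (zero_add n) rfl (by simp)

open CategoryTheory Abelian in
theorem aux_injDim {C : Type*} [Category C] [Abelian C] {D : Type*} [Category D] [Abelian D]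
    [HasExt.{u} C] [HasExt.{u} D] [EnoughInjectives C]
    (F : C ⥤ D) [F.Additive] [Limits.PreservesFiniteLimits F] [Limits.PreservesFiniteColimits F]
    (G : D ⥤ C) [G.Additive] [Limits.PreservesFiniteLimits G] [Limits.PreservesFiniteColimits G]
    (η : F ⋙ G ≅ 𝟭 C) (n : ℕ) (Y : C) (h : HasInjectiveDimensionLT (F.obj Y) n) :
    HasInjectiveDimensionLT Y n := by
  rw [hasInjectiveDimensionLT_iff.{u}]
  intro i hi X e
  have h0 : e.mapExactFunctor F = 0 := Ext.eq_zero_of_hasInjectiveDimensionLT _ n hi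
  have h1 := aux_ext_s10 F G η i X Y e
  rw [h0, Ext.mapExactFunctor_zero, Ext.zero_comp] at h1
  have h2 : (Ext.mk₀ (η.inv.app X)).comp ((Ext.mk₀ (η.hom.app X)).comp e (zero_add i))
      (zero_add i) = e := by
    rw [← Ext.comp_assoc _ _ _ (add_zero 0) (zero_add i) (by simp), Ext.mk₀_comp_mk₀]
    erw [Iso.inv_hom_id_app]
    exact Ext.mk₀_id_comp e
  rw [← h2, ← h1]
  simp

theorem aux_dualSES {R : Type u} [CommRing R] {K A B : Type u} [AddCommGroup K] [AddCommGroup A]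
    [AddCommGroup B] [Module R K] [Module R A] [Module R B] (i : K →ₗ[R] A) (p : A →ₗ[R] B)
    (hi : Function.Injective i) (hp : Function.Surjective p) (hip : Function.Exact i p) :
    ∃ h, (ShortComplex.moduleCatMk (CharacterModule.dual p) (CharacterModule.dual i) h).ShortExact := by
  have h : (CharacterModule.dual i).comp (CharacterModule.dual p) = 0 := by
    rw [← CharacterModule.dual_comp, hip.linearMap_comp_eq_zero, CharacterModule.dual_zero]
  refine ⟨h, ?_⟩
  refine { exact := ?_, mono_f := ?_, epi_g := ?_ }
  · rw [ShortComplex.moduleCat_exact_iff]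
    intro c hc
    change CharacterModule A at c
    change CharacterModule.dual i c = 0 at hc
    refine ⟨(p.toAddMonoidHom.liftOfSurjective hp ⟨(c : A →+ _), ?_⟩ : B →+ _), ?_⟩
    · intro a ha
      obtain ⟨k, rfl⟩ := (hip a).1 ha
      exact DFunLike.congr_fun hc k
    · refine CharacterModule.ext A fun a => ?_
      exact p.toAddMonoidHom.liftOfRightInverse_comp_apply _ (Function.rightInverse_surjInv hp) ⟨(c : A →+ _), _⟩ a
  · exact (ModuleCat.mono_iff_injective _).2 (CharacterModule.dual_injective_of_surjective p hp)
  · exact (ModuleCat.epi_iff_surjective _).2 (CharacterModule.dual_surjective_of_injective i hi)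

theorem aux_flat_iff (R : Type u) [CommRing R] (M : Type u) [AddCommGroup M] [Module R M] :
    Module.Flat R M ↔ HasInjectiveDimensionLT (ModuleCat.of R (CharacterModule M)) 1 := by
  rw [Module.Flat.iff_characterModule_injective, Module.injective_iff_injective_object,
    injective_iff_hasInjectiveDimensionLT_one]

theorem aux_of_res (R : Type u) [CommRing R] (n : ℕ) : ∀ (M : Type u) [AddCommGroup M] [Module R M],
    HasLeftResLE R (fun N => Module.Flat R N) M n →
    HasInjectiveDimensionLT (ModuleCat.of R (CharacterModule M)) (n + 1) := by
  induction n with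
  | zero =>
    rintro M _ _ ⟨G, d, aug, hG, hz, hs, he, hd⟩
    refine (aux_flat_iff R M).1 ?_
    have hinj : Function.Injective aug.hom := by
      rw [injective_iff_map_eq_zero]
      intro x hx
      obtain ⟨y, rfl⟩ := (he x).1 hx
      have := hz 1 (by simp)
      rw [Subsingleton.elim y 0]
      exact map_zero (d 0).hom
    have := hG 0
    exact Module.Flat.of_linearEquiv (LinearEquiv.ofBijective aug.hom ⟨hinj, hs⟩).symm
  | succ n ih =>
    rintro M _ _ ⟨G, d, aug, hG, hz, hs, he, hd⟩
    have hK : HasLeftResLE R (fun N => Module.Flat R N) (LinearMap.ker aug.hom) n := by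
      refine ⟨fun i => G (i + 1), fun i => d (i + 1),
        ModuleCat.ofHom ((d 0).hom.codRestrict (LinearMap.ker aug.hom)
          (fun x => (he _).2 ⟨x, rfl⟩)), fun i => hG _, fun i hi => hz _ (by omega), ?_, ?_,
          fun i => hd _⟩
      · rintro ⟨x, hx⟩
        obtain ⟨y, hy⟩ := (he x).1 hx
        exact ⟨y, Subtype.ext hy⟩
      · intro x
        rw [← hd 0 x]
        exact Subtype.ext_iff
    obtain ⟨h, hS⟩ := aux_dualSES (LinearMap.ker aug.hom).subtype aug.hom
      (Submodule.injective_subtype _) hs (LinearMap.exact_subtype_ker_map _)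
    have hG0 : HasInjectiveDimensionLT (ModuleCat.of R (CharacterModule (G 0))) 1 :=
      (aux_flat_iff R (G 0)).1 (hG 0)
    exact hS.hasInjectiveDimensionLT_X₁ (n + 1) (ih _ hK)
      (@hasInjectiveDimensionLT_of_ge _ _ _ _ 1 _ (by omega) hG0)

def auxG {R : Type u} [CommRing R] (P : ModuleCat.{u} R) (G : ℕ → ModuleCat.{u} R) :
    ℕ → ModuleCat.{u} R
  | 0 => P
  | i + 1 => G i

def auxd {R : Type u} [CommRing R] (P : ModuleCat.{u} R) (G : ℕ → ModuleCat.{u} R)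
    (d : ∀ i, G (i + 1) ⟶ G i) (f : G 0 ⟶ P) : ∀ i, auxG P G (i + 1) ⟶ auxG P G i
  | 0 => f
  | i + 1 => d i

theorem aux_to_res (R : Type u) [CommRing R] (n : ℕ) : ∀ (M : Type u) [AddCommGroup M] [Module R M],
    HasInjectiveDimensionLT (ModuleCat.of R (CharacterModule M)) (n + 1) →
    HasLeftResLE R (fun N => Module.Flat R N) M n := by
  induction n with
  | zero =>
    intro M _ _ h
    have hM := (aux_flat_iff R M).2 h
    refine ⟨auxG (ModuleCat.of R M) (fun _ => ModuleCat.of R PUnit.{u + 1}),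
      auxd _ _ (fun _ => 0) 0, 𝟙 (ModuleCat.of R M), ?_, ?_, fun x => ⟨x, rfl⟩, ?_, ?_⟩
    · rintro (_ | i)
      · exact hM
      · exact (inferInstance : Module.Flat R PUnit.{u + 1})
    · rintro (_ | i) hi
      · omega
      · exact (inferInstance : Subsingleton PUnit.{u + 1})
    · intro x
      constructor
      · intro hx
        exact ⟨PUnit.unit, hx.symm⟩
      · rintro ⟨y, rfl⟩
        rfl
    · intro i x
      constructor
      · intro _
        exact ⟨PUnit.unit, (inferInstance : Subsingleton PUnit.{u + 1}).elim _ _⟩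
      · rintro ⟨y, rfl⟩
        cases i <;> rfl
  | succ n ih =>
    intro M _ _ h
    obtain ⟨P, _, _, hPf, p, hp⟩ : ∃ (P : Type u) (_ : AddCommGroup P) (_ : Module R P),
        Module.Flat R P ∧ ∃ p : P →ₗ[R] M, Function.Surjective p :=
      ⟨M →₀ R, inferInstance, inferInstance, inferInstance, Finsupp.linearCombination R id,
        Finsupp.linearCombination_id_surjective R M⟩
    obtain ⟨h', hS⟩ := aux_dualSES (R := R) (Submodule.subtype (LinearMap.ker p)) p
      (Submodule.injective_subtype _) hp (LinearMap.exact_subtype_ker_map p)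
    have hP : HasInjectiveDimensionLT (ModuleCat.of R (CharacterModule P)) 1 :=
      (aux_flat_iff R _).1 inferInstance
    obtain ⟨G, d, aug, hG, hz, hs, he, hd⟩ := ih (LinearMap.ker p)
      (hS.hasInjectiveDimensionLT_X₃ (n + 1) (@hasInjectiveDimensionLT_of_ge _ _ _ _ 1 _ (by omega) hP) h)
    refine ⟨auxG (ModuleCat.of R P) G,
      auxd _ _ d (aug ≫ ModuleCat.ofHom (LinearMap.ker p).subtype), ModuleCat.ofHom p,
      ?_, ?_, hp, ?_, ?_⟩
    · rintro (_ | i)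
      · exact hPf
      · exact hG i
    · rintro (_ | i) hi
      · omega
      · exact hz i (by omega)
    · intro x
      constructor
      · intro hx
        obtain ⟨y, hy⟩ := hs ⟨x, hx⟩
        exact ⟨y, congrArg Subtype.val hy⟩
      · rintro ⟨y, rfl⟩
        exact (aug y).2
    · rintro (_ | i)
      · intro x
        refine Iff.trans ?_ (he x)
        exact ⟨fun h => Subtype.ext h, fun h => congrArg Subtype.val h⟩
      · exact hd i

theorem stmt10 (R E : Type u) [CommRing R] [AddCommGroup E] [Module R E]
    [Module Rᵐᵒᵖ E] [IsCentralScalar R E]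
    (M : Type u) [AddCommGroup M] [Module R M] :
    flatDim R M ≤ @flatDim (TrivSqZeroExt R E) _ M _ (Module.compHom M (paperEps R E)) := by
  unfold flatDim
  refine sInf_le_sInf (Set.image_mono ?_)
  intro n hn
  refine aux_to_res R n M ?_
  have h := @aux_of_res (TrivSqZeroExt R E) _ n M _ (Module.compHom M (paperEps R E)) hn
  let φ : R →+* TrivSqZeroExt R E := TrivSqZeroExt.inlHom R E
  have hφ : RingHom.id R = (paperEps R E).comp φ := by
    ext r; rfl
  refine aux_injDim (ModuleCat.restrictScalars.{u} (paperEps R E)) (ModuleCat.restrictScalars.{u} φ)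
    ((ModuleCat.restrictScalarsComp' φ (paperEps R E) _ hφ).symm ≪≫
      ModuleCat.restrictScalarsId' _ rfl) (n + 1) _ ?_
  exact h
end
end
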